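/- arXiv:1409.5376 — 3 statements merged into one kernel-verified Lean document; each statement's English description precedes it below -/
import Mathlib

section
/- Let L ≥ 0 and let c : ℝ → ℝ be Lipschitz continuous with constant L. Let T > 0, let 0 < t₁ < t₂ < ⋯ < t_n ≤ T be finitely many points, and let x, y : [0,T] → ℝ be right-continuous functions which possess left limits x(t_i⁻), y(t_i⁻) at each t_i, are differentiable on each of the open intervals (0,t₁), (t₁,t₂), …, (t_n,T) with x′(t) = −c(x(t)) and y′(t) = −c(y(t)) there, and whose jumps coincide: x(t_i) − x(t_i⁻) = y(t_i) − y(t_i⁻) for every i = 1,…,n. Then for every t ∈ [0,T], |x(t) − y(t)| ≤ |x(0) − y(0)| · e^{L t}. -/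
open Filter

/-- A function continuous on `[a, b]` whose derivative exists and is nonpositive in `(a, b)`
off a finite set satisfies `g b ≤ g a`. -/
theorem le_of_hasDerivAt_nonpos_off_finset {g g' : ℝ → ℝ} (F : Finset ℝ) {a b : ℝ}
    (hab : a ≤ b) (hg : ContinuousOn g (Set.Icc a b))
    (hg' : ∀ s ∈ Set.Ioo a b, s ∉ F → HasDerivAt g (g' s) s ∧ g' s ≤ 0) : g b ≤ g a := by
  induction F using Finset.induction_on generalizing a b with
  | empty =>
    have hderiv : ∀ s ∈ Set.Ioo a b, HasDerivAt g (g' s) s ∧ g' s ≤ 0 :=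
      fun s hs => hg' s hs (Finset.notMem_empty s)
    refine antitoneOn_of_deriv_nonpos (convex_Icc a b) hg ?_ ?_
      (Set.left_mem_Icc.2 hab) (Set.right_mem_Icc.2 hab) hab
    · rw [interior_Icc]
      exact fun s hs => (hderiv s hs).1.differentiableAt.differentiableWithinAt
    · rw [interior_Icc]
      intro s hs
      rw [(hderiv s hs).1.deriv]
      exact (hderiv s hs).2
  | insert p F _ ih =>
    by_cases hp : p ∈ Set.Ioo a b
    · refine (ih hp.2.le (hg.mono (Set.Icc_subset_Icc_left hp.1.le)) fun s hs hsF => ?_).trans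
        (ih hp.1.le (hg.mono (Set.Icc_subset_Icc_right hp.2.le)) fun s hs hsF => ?_)
      · exact hg' s ⟨hp.1.trans hs.1, hs.2⟩ (by simp [hs.1.ne', hsF])
      · exact hg' s ⟨hs.1, hs.2.trans hp.2⟩ (by simp [hs.2.ne, hsF])
    · refine ih hab hg fun s hs hsF => hg' s hs ?_
      rw [Finset.mem_insert, not_or]
      exact ⟨fun h => hp (h ▸ hs), hsF⟩

/-- Grönwall's inequality for a continuous function that satisfies `|f'| ≤ K |f|`
off a finite set. -/
theorem abs_le_mul_exp_of_abs_deriv_le_off_finset {f f' : ℝ → ℝ} {K : ℝ} (F : Finset ℝ)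
    {a b : ℝ} (hab : a ≤ b) (hf : ContinuousOn f (Set.Icc a b))
    (hf' : ∀ s ∈ Set.Ioo a b, s ∉ F → HasDerivAt f (f' s) s ∧ |f' s| ≤ K * |f s|) :
    |f b| ≤ |f a| * Real.exp (K * (b - a)) := by
  have hdecay := le_of_hasDerivAt_nonpos_off_finset
    (g := fun s => (f s * Real.exp (-(K * (s - a)))) ^ 2)
    (g' := fun s => 2 * (f s * f' s - K * f s ^ 2) * Real.exp (-(K * (s - a))) ^ 2)
    F hab (by fun_prop) fun s hs hsF => ?_
  · have habs := sq_le_sq.1 hdecay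
    simp only [sub_self, mul_zero, neg_zero, Real.exp_zero, mul_one, abs_mul, Real.abs_exp]
      at habs
    rwa [Real.exp_neg, ← div_eq_mul_inv, div_le_iff₀ (Real.exp_pos _)] at habs
  · obtain ⟨hderiv, hbound⟩ := hf' s hs hsF
    constructor
    · have hexp : HasDerivAt (fun s => Real.exp (-(K * (s - a))))
          (Real.exp (-(K * (s - a))) * -(K * 1)) s :=
        (((hasDerivAt_id s).sub_const a).const_mul K).neg.exp
      refine ((hderiv.mul hexp).pow 2).congr_deriv ?_
      simp only [Pi.mul_apply]
      ring
    · have hprod : f s * f' s ≤ K * f s ^ 2 := calc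
        f s * f' s ≤ |f s| * |f' s| := (le_abs_self _).trans (abs_mul _ _).le
        _ ≤ |f s| * (K * |f s|) := by gcongr
        _ = K * f s ^ 2 := by rw [← sq_abs]; ring
      exact mul_nonpos_of_nonpos_of_nonneg (by linarith) (sq_nonneg _)

/-- Pathwise content of Lemma 3.1: two càdlàg paths following the ODE
`R' = -c(R)` (`c` Lipschitz with constant `L`) between the jump times
`t 1 < ⋯ < t n` and receiving identical jumps stay within
`|x 0 - y 0| e^{L t}` of each other. -/
theorem gronwall_with_common_jumps
    (L : ℝ) (hL : 0 ≤ L) (c : ℝ → ℝ)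
    (hc : ∀ a b : ℝ, |c a - c b| ≤ L * |a - b|)
    (T : ℝ) (hT : 0 < T)
    (n : ℕ) (t : Fin n → ℝ) (ht_mono : StrictMono t)
    (ht_pos : ∀ i, 0 < t i) (ht_le : ∀ i, t i ≤ T)
    (x y : ℝ → ℝ) (xl yl : Fin n → ℝ)
    -- right-continuity of the paths on [0,T)
    (hx_rc : ∀ s ∈ Set.Ico (0 : ℝ) T, Tendsto x (nhdsWithin s (Set.Ioi s)) (nhds (x s)))
    (hy_rc : ∀ s ∈ Set.Ico (0 : ℝ) T, Tendsto y (nhdsWithin s (Set.Ioi s)) (nhds (y s)))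
    -- continuity (within [0,T]) away from the jump times: jumps occur only at the t i
    (hx_cont : ∀ s ∈ Set.Icc (0 : ℝ) T, (∀ i, s ≠ t i) →
      ContinuousWithinAt x (Set.Icc 0 T) s)
    (hy_cont : ∀ s ∈ Set.Icc (0 : ℝ) T, (∀ i, s ≠ t i) →
      ContinuousWithinAt y (Set.Icc 0 T) s)
    -- existence of left limits at each jump time
    (hxl : ∀ i, Tendsto x (nhdsWithin (t i) (Set.Iio (t i))) (nhds (xl i)))
    (hyl : ∀ i, Tendsto y (nhdsWithin (t i) (Set.Iio (t i))) (nhds (yl i)))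
    -- the ODE holds on each open interval between consecutive jump times
    (hx_ode : ∀ s ∈ Set.Ioo (0 : ℝ) T, (∀ i, s ≠ t i) → HasDerivAt x (-c (x s)) s)
    (hy_ode : ∀ s ∈ Set.Ioo (0 : ℝ) T, (∀ i, s ≠ t i) → HasDerivAt y (-c (y s)) s)
    -- the jumps of the two paths coincide
    (hjump : ∀ i, x (t i) - xl i = y (t i) - yl i) :
    ∀ s ∈ Set.Icc (0 : ℝ) T, |x s - y s| ≤ |x 0 - y 0| * Real.exp (L * s) := by
  intro s hs
  have hcont : ContinuousOn (fun u => x u - y u) (Set.Icc 0 T) := by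
    intro u hu
    by_cases hut : ∀ i, u ≠ t i
    · exact (hx_cont u hu hut).sub (hy_cont u hu hut)
    · push Not at hut
      obtain ⟨i, rfl⟩ := hut
      have hleft : ContinuousWithinAt (fun u => x u - y u) (Set.Iic (t i)) (t i) := by
        rw [← continuousWithinAt_Iio_iff_Iic]
        have hlim : xl i - yl i = x (t i) - y (t i) := by linarith [hjump i]
        simpa only [ContinuousWithinAt, hlim] using (hxl i).sub (hyl i)
      rcases hu.2.lt_or_eq with hlt | heq
      · have hright : ContinuousWithinAt (fun u => x u - y u) (Set.Ici (t i)) (t i) := by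
          rw [← continuousWithinAt_Ioi_iff_Ici]
          exact (hx_rc _ ⟨hu.1, hlt⟩).sub (hy_rc _ ⟨hu.1, hlt⟩)
        exact (continuousAt_iff_continuous_left_right.2 ⟨hleft, hright⟩).continuousWithinAt
      · exact hleft.mono fun v hv => hv.2.trans heq.ge
  have hbound := abs_le_mul_exp_of_abs_deriv_le_off_finset
    (f := fun u => x u - y u) (f' := fun u => -c (x u) - -c (y u)) (K := L)
    (Finset.univ.image t) hs.1 (hcont.mono (Set.Icc_subset_Icc_right hs.2)) fun u hu hut => ?_
  · simpa only [sub_zero] using hbound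
  · have hne : ∀ i, u ≠ t i := fun i hi => hut (by simp [hi])
    have huT : u ∈ Set.Ioo 0 T := ⟨hu.1, hu.2.trans_le hs.2⟩
    refine ⟨(hx_ode u huT hne).sub (hy_ode u huT hne), ?_⟩
    rw [neg_sub_neg, abs_sub_comm]
    exact hc _ _
end

section
/- Comparison principle: Let u : [m,M] → ℝ be a bounded upper semicontinuous viscosity subsolution and v : [m,M] → ℝ a bounded lower semicontinuous viscosity supersolution of the HJB equation min{ δ f(r) − A(f)(r) − G(r), f(r) − (M f)(r) } = 0 on [m,M]. If u(m) ≤ v(m) and u(M) ≤ v(M), then u(r) ≤ v(r) for all r ∈ [m,M]. -/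
open MeasureTheory Set

/-- Intervention operator
`(M u)(r) = sup_{0 ≤ ζ ≤ M - r} ( u(r+ζ) - H(r+ζ) + H(r) - k )`. -/
noncomputable def Mop (M k : ℝ) (H u : ℝ → ℝ) (r : ℝ) : ℝ :=
  sSup ((fun ζ : ℝ => u (r + ζ) - H (r + ζ) + H r - k) '' Icc 0 (M - r))

/-- Integro-differential operator
`A(φ,u)(r) = -c(r) φ'(r) + λ ( ∫_{[0, r-m]} u(r-s) dμ(s) - u(r) )`. -/
noncomputable def Aop (m lam : ℝ) (c : ℝ → ℝ) (μ : Measure ℝ)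
    (φ u : ℝ → ℝ) (r : ℝ) : ℝ :=
  -c r * deriv φ r + lam * ((∫ s in Icc 0 (r - m), u (r - s) ∂μ) - u r)

/-- `u` is a viscosity subsolution of the HJB equation
`min { δ f - A(f) - G , f - M f } = 0` on `[m, M]`. -/
def IsViscositySubsolution (m M lam δ k : ℝ) (c : ℝ → ℝ) (μ : Measure ℝ)
    (G H : ℝ → ℝ) (u : ℝ → ℝ) : Prop :=
  ∀ φ : ℝ → ℝ, ContDiff ℝ 1 φ →
    ∀ r ∈ Ioo m M, (∀ z ∈ Icc m M, u z - φ z ≤ u r - φ r) → u r = φ r →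
      min (δ * φ r - Aop m lam c μ φ u r - G r) (u r - Mop M k H u r) ≤ 0

/-- `v` is a viscosity supersolution of the HJB equation
`min { δ f - A(f) - G , f - M f } = 0` on `[m, M]`. -/
def IsViscositySupersolution (m M lam δ k : ℝ) (c : ℝ → ℝ) (μ : Measure ℝ)
    (G H : ℝ → ℝ) (v : ℝ → ℝ) : Prop :=
  ∀ φ : ℝ → ℝ, ContDiff ℝ 1 φ →
    ∀ r ∈ Ioo m M, (∀ z ∈ Icc m M, v r - φ r ≤ v z - φ z) → v r = φ r →
      0 ≤ min (δ * φ r - Aop m lam c μ φ v r - G r) (v r - Mop M k H v r)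

open Filter Topology

/-- `p` is the slope at `ξ` of a continuously differentiable function that touches `f` from above
at `ξ` relative to `[m, M]`. -/
def IsSuperslope (m M : ℝ) (f : ℝ → ℝ) (ξ p : ℝ) : Prop :=
  ∃ φ : ℝ → ℝ, ContDiff ℝ 1 φ ∧ deriv φ ξ = p ∧
    (∀ z ∈ Icc m M, f z - φ z ≤ f ξ - φ ξ) ∧ f ξ = φ ξ

/-- Touching from above near `ξ` suffices for a function that is bounded above. -/
lemma isSuperslope_of_eventually {m M C ξ : ℝ} {f φ : ℝ → ℝ}
    (hf : ∀ z ∈ Icc m M, f z ≤ C) (hφ : ContDiff ℝ 1 φ)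
    (hloc : ∀ᶠ z in 𝓝 ξ, z ∈ Icc m M → f z - φ z ≤ f ξ - φ ξ) :
    IsSuperslope m M f ξ (deriv φ ξ) := by
  obtain ⟨ρ, hρ, hball⟩ := Metric.eventually_nhds_iff.1 hloc
  obtain ⟨B, hB⟩ := (isCompact_Icc (a := m) (b := M)).exists_bound_of_continuousOn
    hφ.continuous.continuousOn
  set N : ℝ := |C + B - f ξ + φ ξ| / ρ ^ 2 with hN
  have hN0 : 0 ≤ N := by positivity
  have hNρ : N * ρ ^ 2 = |C + B - f ξ + φ ξ| := by rw [hN]; field_simp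
  refine ⟨fun x => φ x - φ ξ + f ξ + N * (x - ξ) ^ 2, by fun_prop, ?_, ?_, by simp⟩
  · have h1 : HasDerivAt φ (deriv φ ξ) ξ := (hφ.differentiable (by norm_num) ξ).hasDerivAt
    have h2 : HasDerivAt (fun x : ℝ => N * (x - ξ) ^ 2) (N * (2 * (ξ - ξ) ^ 1 * 1)) ξ :=
      (((hasDerivAt_id ξ).sub_const ξ).pow 2).const_mul N
    have h3 := ((h1.sub_const (φ ξ)).add_const (f ξ)).fun_add h2
    simpa using h3.deriv
  · intro z hz
    by_cases hd : dist z ξ < ρ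
    · have := hball hd hz
      have : 0 ≤ N * (z - ξ) ^ 2 := by positivity
      simp only [sub_self, ne_eq, OfNat.ofNat_ne_zero, not_false_eq_true, zero_pow, mul_zero]
      linarith
    · have h1 : ρ ^ 2 ≤ (z - ξ) ^ 2 := by
        rw [not_lt, Real.dist_eq] at hd
        rw [← sq_abs (z - ξ)]
        gcongr
      have h2 : N * ρ ^ 2 ≤ N * (z - ξ) ^ 2 := by gcongr
      have h3 := hf z hz
      have h4 := (abs_le.1 (hB z hz)).1
      have h5 := le_abs_self (C + B - f ξ + φ ξ)
      simp only [sub_self, ne_eq, OfNat.ofNat_ne_zero, not_false_eq_true, zero_pow, mul_zero]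
      linarith

/-- A function that is `o(t)` at the origin is dominated near the origin by a continuously
differentiable function with vanishing value and derivative there. -/
lemma exists_contDiff_majorant {h : ℝ → ℝ} (h0 : h 0 = 0)
    (hh : ∀ ε > 0, ∀ᶠ t in 𝓝 (0 : ℝ), h t ≤ ε * |t|) :
    ∃ g : ℝ → ℝ, ContDiff ℝ 1 g ∧ g 0 = 0 ∧ deriv g 0 = 0 ∧ ∀ᶠ t in 𝓝 (0 : ℝ), h t ≤ g t := by
  have hρ : ∀ n : ℕ, ∃ ρ : ℝ, 0 < ρ ∧ ρ ≤ (1 / 2) ^ n ∧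
      ∀ t : ℝ, |t| < ρ → h t ≤ (1 / 2) ^ n * |t| := by
    intro n
    obtain ⟨ρ, hρ, hb⟩ := Metric.eventually_nhds_iff.1 (hh ((1 / 2) ^ n) (by positivity))
    refine ⟨min ρ ((1 / 2) ^ n), by positivity, min_le_right _ _, fun t ht => hb ?_⟩
    rw [dist_zero_right, Real.norm_eq_abs]
    exact ht.trans_le (min_le_left _ _)
  choose ρ hρ0 hρn hρh using hρ
  set η : ℕ → ℝ := fun n => ρ (n + 1) / 2 with hη
  have hη0 : ∀ n, 0 < η n := fun n => by have := hρ0 (n + 1); simp only [hη]; positivity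
  have hpos : ∀ n (t : ℝ), 0 < t ^ 2 + η n ^ 2 := fun n t => by have := hη0 n; positivity
  set q : ℕ → ℝ → ℝ := fun n t => 2 * (1 / 2) ^ n * (√(t ^ 2 + η n ^ 2) - η n) with hq
  set q' : ℕ → ℝ → ℝ := fun n t => 2 * (1 / 2) ^ n * (t / √(t ^ 2 + η n ^ 2)) with hq'
  have hsum : Summable (fun n : ℕ => 2 * (1 / 2 : ℝ) ^ n) := summable_geometric_two.mul_left 2
  have hder : ∀ n t, HasDerivAt (q n) (q' n t) t := by
    intro n t
    have h1 : HasDerivAt (fun t : ℝ => t ^ 2 + η n ^ 2) (2 * t) t := by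
      simpa using ((hasDerivAt_id t).pow 2).add_const (η n ^ 2)
    have h2 := ((h1.sqrt (hpos n t).ne').sub_const (η n)).const_mul (2 * (1 / 2 : ℝ) ^ n)
    refine h2.congr_deriv ?_
    simp only [hq']
    congr 1
    rw [mul_div_mul_left _ _ two_ne_zero]
  have hbound : ∀ n t, ‖q' n t‖ ≤ 2 * (1 / 2 : ℝ) ^ n := by
    intro n t
    have h1 : |t / √(t ^ 2 + η n ^ 2)| ≤ 1 := by
      rw [abs_div, abs_of_nonneg (Real.sqrt_nonneg _)]
      refine div_le_one_of_le₀ (Real.abs_le_sqrt ?_) (Real.sqrt_nonneg _)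
      nlinarith [sq_nonneg (η n)]
    simp only [hq', norm_mul, Real.norm_eq_abs]
    rw [abs_of_pos (by norm_num : (0 : ℝ) < 2), abs_of_pos (by positivity : (0 : ℝ) < (1 / 2) ^ n)]
    exact mul_le_of_le_one_right (by positivity) h1
  have hq0 : ∀ n, q n 0 = 0 := fun n => by simp [hq, Real.sqrt_sq (hη0 n).le]
  have hq'0 : ∀ n, q' n 0 = 0 := fun n => by simp [hq']
  have hD : ∀ t, HasDerivAt (fun t => ∑' n, q n t) (∑' n, q' n t) t :=
    hasDerivAt_tsum (y₀ := 0) hsum hder hbound (by simp [hq0])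
  have hsumq : ∀ t, Summable fun n => q n t :=
    summable_of_summable_hasDerivAt (y₀ := 0) hsum hder hbound (by simp [hq0])
  have hqnn : ∀ n t, 0 ≤ q n t := by
    intro n t
    have : η n ≤ √(t ^ 2 + η n ^ 2) := Real.le_sqrt_of_sq_le (by nlinarith [sq_nonneg t])
    have : 0 ≤ √(t ^ 2 + η n ^ 2) - η n := by linarith
    simp only [hq]
    positivity
  refine ⟨fun t => ∑' n, q n t, ?_, by simp [hq0], ?_, ?_⟩
  · rw [contDiff_one_iff_deriv]
    refine ⟨fun t => (hD t).differentiableAt, ?_⟩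
    rw [funext fun t => (hD t).deriv]
    refine continuous_tsum (fun n => ?_) hsum hbound
    have : ∀ t : ℝ, √(t ^ 2 + η n ^ 2) ≠ 0 := fun t => (Real.sqrt_pos.2 (hpos n t)).ne'
    exact continuous_const.mul (continuous_id.div (by fun_prop) this)
  · rw [(hD 0).deriv]
    simp [hq'0]
  · refine Metric.eventually_nhds_iff.2 ⟨ρ 0, hρ0 0, fun t ht => ?_⟩
    rw [dist_zero_right, Real.norm_eq_abs] at ht
    rcases eq_or_ne t 0 with rfl | ht0
    · simp [hq0, h0]
    have hex : ∃ n, ρ n ≤ |t| := by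
      obtain ⟨n, hn⟩ := exists_pow_lt_of_lt_one (abs_pos.2 ht0) (by norm_num : (1 / 2 : ℝ) < 1)
      exact ⟨n, (hρn n).trans hn.le⟩
    classical
    obtain ⟨n, hn1, hn2⟩ : ∃ n, |t| < ρ n ∧ ρ (n + 1) ≤ |t| := by
      rcases hk : Nat.find hex with _ | n
      · have := Nat.find_spec hex
        rw [hk] at this
        exact absurd ht (not_lt.2 this)
      · refine ⟨n, not_le.1 (Nat.find_min hex (by omega)), ?_⟩
        have := Nat.find_spec hex
        rwa [hk] at this
    refine ((hρh n t hn1).trans ?_).trans ((hsumq t).le_tsum n fun j _ => hqnn j t)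
    have h1 : |t| ≤ √(t ^ 2 + η n ^ 2) := Real.abs_le_sqrt (by nlinarith [sq_nonneg (η n)])
    have h2 : |t| ≤ 2 * (√(t ^ 2 + η n ^ 2) - η n) := by simp only [hη] at h1 ⊢; linarith
    have h3 : (0 : ℝ) ≤ (1 / 2) ^ n := by positivity
    simp only [hq]
    nlinarith

/-- The derivative of a function bounded above is a superslope. -/
lemma isSuperslope_of_hasDerivAt {m M C ξ p : ℝ} {f : ℝ → ℝ}
    (hf : ∀ z ∈ Icc m M, f z ≤ C) (hd : HasDerivAt f p ξ) : IsSuperslope m M f ξ p := by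
  obtain ⟨g, hg, hg0, hg'0, hle⟩ :=
    exists_contDiff_majorant (h := fun t => f (ξ + t) - f ξ - p * t) (by simp) (by
      intro ε hε
      have := (hasDerivAt_iff_isLittleO_nhds_zero.1 hd).bound hε
      filter_upwards [this] with t ht
      refine (le_abs_self _).trans ?_
      simpa [mul_comm] using ht)
  have hφ : ContDiff ℝ 1 (fun x => p * x + g (x - ξ)) := by fun_prop
  have hderiv : deriv (fun x => p * x + g (x - ξ)) ξ = p := by
    have h1 : HasDerivAt g (deriv g 0) (ξ - ξ) := by
      rw [sub_self]
      exact (hg.differentiable (by norm_num) 0).hasDerivAt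
    have h2 := ((hasDerivAt_id ξ).const_mul p).fun_add (h1.comp_sub_const ξ ξ)
    simpa [hg'0] using h2.deriv
  rw [← hderiv]
  refine isSuperslope_of_eventually hf hφ ?_
  have ht : Tendsto (fun z => z - ξ) (𝓝 ξ) (𝓝 0) := by
    simpa using (continuous_id.sub continuous_const).tendsto (x := ξ) (f := fun z : ℝ => z - ξ)
  filter_upwards [ht.eventually hle] with z hz _
  simp only [add_sub_cancel, sub_self, hg0] at hz ⊢
  linarith

/-- An upper bound on superslopes is a one-sided Lipschitz bound; only superslopes at heights
above `ℓ` matter for increments that stay above `ℓ`. -/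
lemma sub_le_of_superslope_le {m M a b C K ℓ x₀ x₁ : ℝ} {f : ℝ → ℝ}
    (hab : Icc a b ⊆ Icc m M) (hf : ∀ z ∈ Icc m M, f z ≤ C)
    (husc : UpperSemicontinuousOn f (Icc m M)) (hK : 0 ≤ K)
    (hslope : ∀ ξ ∈ Ioo a b, ∀ p, ℓ < f ξ → IsSuperslope m M f ξ p → p ≤ K)
    (h0 : a ≤ x₀) (h01 : x₀ ≤ x₁) (h1 : x₁ < b) (hℓ : ℓ < f x₁ - K * (x₁ - x₀)) :
    f x₁ - K * (x₁ - x₀) ≤ f x₀ := by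
  by_contra! hlt
  rcases h01.eq_or_lt with rfl | h01
  · simp at hlt
  obtain ⟨ε, hε, hε1, hε2⟩ : ∃ ε > 0, ε < f x₁ - K * (x₁ - x₀) - f x₀ ∧
      ε < f x₁ - K * (x₁ - x₀) - ℓ := by
    obtain ⟨ε, hε, h⟩ := exists_between
      (lt_min (sub_pos.2 hlt) (sub_pos.2 hℓ))
    exact ⟨ε, hε, h.trans_le (min_le_left _ _), h.trans_le (min_le_right _ _)⟩
  obtain ⟨N, hN, hNb⟩ : ∃ N > 0, |f b - f x₁| + 2 * ε ≤ ε * Real.exp (N * (b - x₁)) := by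
    have hb : 0 < b - x₁ := sub_pos.2 h1
    refine ⟨(|f b - f x₁| / ε + 1) / (b - x₁), by positivity, ?_⟩
    rw [div_mul_cancel₀ _ hb.ne']
    have := Real.add_one_le_exp (|f b - f x₁| / ε + 1)
    calc |f b - f x₁| + 2 * ε = ε * (|f b - f x₁| / ε + 2) := by field_simp
      _ ≤ _ := by gcongr; linarith
  set φ : ℝ → ℝ := fun x => K * x + ε * Real.exp (N * (x - x₁)) with hφdef
  have hφ : ContDiff ℝ 1 φ := by fun_prop
  have hφ' : ∀ x, deriv φ x = K + ε * (Real.exp (N * (x - x₁)) * N) := by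
    intro x
    have h2 : HasDerivAt (fun x => N * (x - x₁)) N x := by
      simpa using ((hasDerivAt_id x).sub_const x₁).const_mul N
    have h3 := ((hasDerivAt_id x).const_mul K).fun_add (h2.exp.const_mul ε)
    simpa using h3.deriv
  have hsub : Icc x₀ b ⊆ Icc m M := (Icc_subset_Icc_left h0).trans hab
  have husc' : UpperSemicontinuousOn (fun x => f x + -φ x) (Icc x₀ b) :=
    (husc.mono hsub).add hφ.continuous.neg.continuousOn.upperSemicontinuousOn
  obtain ⟨ξ, hξ, hmax⟩ := husc'.exists_isMaxOn
    (nonempty_Icc.2 (h01.trans h1).le) isCompact_Icc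
  have hmax' : ∀ z ∈ Icc x₀ b, f z - φ z ≤ f ξ - φ ξ := by
    intro z hz
    simpa [sub_eq_add_neg] using hmax hz
  have hx1 := hmax' x₁ ⟨h01.le, h1.le⟩
  have hφ1 : φ x₁ = K * x₁ + ε := by simp [hφdef]
  have hexp := fun x : ℝ => mul_pos hε (Real.exp_pos (N * (x - x₁)))
  have hne0 : ξ ≠ x₀ := by
    rintro rfl
    have := hexp ξ
    rw [hφ1] at hx1
    simp only [hφdef] at hx1
    linarith
  have hneb : ξ ≠ b := by
    rintro rfl
    have := le_abs_self (f ξ - f x₁)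
    have : K * x₁ ≤ K * ξ := mul_le_mul_of_nonneg_left h1.le hK
    rw [hφ1] at hx1
    simp only [hφdef] at hx1
    linarith
  have hξ0 : x₀ < ξ := lt_of_le_of_ne hξ.1 hne0.symm
  have hξb : ξ < b := lt_of_le_of_ne hξ.2 hneb
  have hp := hslope ξ ⟨h0.trans_lt hξ0, hξb⟩ (deriv φ ξ) ?_ (isSuperslope_of_eventually hf hφ ?_)
  · rw [hφ'] at hp
    have : 0 < ε * (Real.exp (N * (ξ - x₁)) * N) := by positivity
    linarith
  · have := hexp ξ
    have : K * x₀ ≤ K * ξ := mul_le_mul_of_nonneg_left hξ.1 hK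
    rw [hφ1] at hx1
    simp only [hφdef] at hx1
    linarith
  · filter_upwards [Ioo_mem_nhds hξ0 hξb] with z hz _
    exact hmax' z (Ioo_subset_Icc_self hz)

/-- The derivative of a monotone function is, at some point outside a given null set, at most
the mean slope. -/
lemma MonotoneOn.exists_deriv_le_slope {a b : ℝ} {f : ℝ → ℝ} {P : ℝ → Prop} (hab : a < b)
    (hf : MonotoneOn f (Icc a b)) (hP : ∀ᵐ x, x ∈ Ioo a b → P x) :
    ∃ x ∈ Ioo a b, P x ∧ deriv f x * (b - a) ≤ f b - f a := by
  have hf' : MonotoneOn f (uIcc a b) := by rwa [uIcc_of_le hab.le]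
  have hint := hf'.intervalIntegrable_deriv
  have hle := hf'.intervalIntegral_deriv_mem_uIcc
  rw [uIcc_of_le (sub_nonneg.2 (hf (left_mem_Icc.2 hab.le) (right_mem_Icc.2 hab.le) hab.le))] at hle
  by_contra! hcon
  have hlt : ∀ᵐ x, x ∈ Ioo a b → (f b - f a) / (b - a) < deriv f x := by
    filter_upwards [hP] with x hx hxm
    rw [div_lt_iff₀ (sub_pos.2 hab)]
    exact hcon x hxm (hx hxm)
  have hconst : ∫ _ in a..b, (f b - f a) / (b - a) = f b - f a := by
    have := (sub_pos.2 hab).ne'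
    rw [intervalIntegral.integral_const, smul_eq_mul]
    field_simp
  have hIoc : ∀ᵐ x, x ∈ Ioc a b → (f b - f a) / (b - a) < deriv f x := by
    filter_upwards [hlt, (Set.finite_singleton b).measure_zero volume |> compl_mem_ae_iff.2]
      with x hx hxb hxm
    exact hx ⟨hxm.1, lt_of_le_of_ne hxm.2 hxb⟩
  have := intervalIntegral.integral_lt_integral_of_ae_le_of_measure_setOfPred_lt_ne_zero
    (f := fun _ => (f b - f a) / (b - a)) hab.le intervalIntegrable_const hint
    ((ae_restrict_iff' measurableSet_Ioc).2 (hIoc.mono fun x hx hm => (hx hm).le)) (by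
      intro h0
      have h1 : ∀ᵐ x ∂(volume.restrict (Ioc a b)), (f b - f a) / (b - a) < deriv f x :=
        (ae_restrict_iff' measurableSet_Ioc).2 hIoc
      have h2 : (volume.restrict (Ioc a b)) Set.univ = 0 := by
        refine measure_mono_null ?_ (measure_union_null h0 h1)
        intro x _
        by_cases hx : (f b - f a) / (b - a) < deriv f x
        · exact Or.inl hx
        · exact Or.inr hx
      simp at h2
      linarith)
  rw [hconst] at this
  linarith [hle.2]

/-- The differential inequality satisfied by a subsolution where intervention is suboptimal. -/
lemma IsViscositySubsolution.superslope_le {m M lam δ k ξ p : ℝ} {c G H u : ℝ → ℝ}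
    {μ : Measure ℝ} (hu : IsViscositySubsolution m M lam δ k c μ G H u) (hξ : ξ ∈ Ioo m M)
    (hM : Mop M k H u ξ < u ξ) (hp : IsSuperslope m M u ξ p) :
    c ξ * p + (δ + lam) * u ξ ≤ lam * (∫ s in Icc 0 (ξ - m), u (ξ - s) ∂μ) + G ξ := by
  obtain ⟨φ, hφ, rfl, hmax, heq⟩ := hp
  rcases min_le_iff.1 (hu φ hφ ξ hξ hmax heq) with h | h
  · rw [Aop, ← heq] at h
    linarith
  · linarith

/-- The inequalities satisfied by a supersolution, in terms of superslopes of its negative. -/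
lemma IsViscositySupersolution.superslope_neg {m M lam δ k ξ p : ℝ} {c G H v : ℝ → ℝ}
    {μ : Measure ℝ} (hv : IsViscositySupersolution m M lam δ k c μ G H v) (hξ : ξ ∈ Ioo m M)
    (hp : IsSuperslope m M (fun x => -v x) ξ p) :
    c ξ * p + lam * (∫ s in Icc 0 (ξ - m), v (ξ - s) ∂μ) + G ξ ≤ (δ + lam) * v ξ ∧
      Mop M k H v ξ ≤ v ξ := by
  obtain ⟨φ, hφ, rfl, hmax, heq⟩ := hp
  have h := le_min_iff.1 (hv (fun x => -φ x) hφ.neg ξ hξ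
    (fun z hz => by linarith [hmax z hz]) (by linarith))
  refine ⟨?_, by linarith [h.2]⟩
  have h1 := h.1
  have h2 : deriv (fun x => -φ x) ξ = -deriv φ ξ := deriv.fun_neg
  rw [Aop, h2, ← heq] at h1
  linarith

/-- Any single intervention is a lower bound for the intervention operator. -/
lemma le_Mop {m M k C r z : ℝ} {H u : ℝ → ℝ} (hH : StrictMonoOn H (Icc m M))
    (hu : ∀ x ∈ Icc m M, u x ≤ C) (hr : r ∈ Icc m M) (hz : z ∈ Icc r M) :
    u z - H z + H r - k ≤ Mop M k H u r := by
  refine le_csSup ⟨C - k, ?_⟩ ⟨z - r, ⟨by linarith [hz.1], by linarith [hz.2]⟩, by simp⟩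
  rintro _ ⟨ζ, hζ, rfl⟩
  have hmem : r + ζ ∈ Icc m M := ⟨by linarith [hr.1, hζ.1], by linarith [hζ.2]⟩
  have h1 := hu _ hmem
  have h2 := hH.monotoneOn hr hmem (by linarith [hζ.1])
  simp only
  linarith

/-- A common upper bound of all interventions bounds the intervention operator. -/
lemma Mop_le {M k B r : ℝ} {H u : ℝ → ℝ} (hr : r ≤ M)
    (h : ∀ z ∈ Icc r M, u z - H z + H r - k ≤ B) : Mop M k H u r ≤ B := by
  refine csSup_le ((nonempty_Icc.2 (sub_nonneg.2 hr)).image _) ?_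
  rintro _ ⟨ζ, hζ, rfl⟩
  exact h _ ⟨by linarith [hζ.1], by linarith [hζ.2]⟩

lemma UpperSemicontinuousOn.integrableOn_sub_left {m M C x : ℝ} {f : ℝ → ℝ} {μ : Measure ℝ}
    [IsProbabilityMeasure μ] (hf : UpperSemicontinuousOn f (Icc m M))
    (hC : ∀ z ∈ Icc m M, |f z| ≤ C) (hx : x ≤ M) :
    IntegrableOn (fun s => f (x - s)) (Icc 0 (x - m)) μ := by
  have hmaps : MapsTo (fun s => x - s) (Icc 0 (x - m)) (Icc m M) :=
    fun s hs => ⟨by linarith [hs.2], by linarith [hs.1]⟩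
  have husc : UpperSemicontinuousOn (fun s => f (x - s)) (Icc 0 (x - m)) :=
    hf.comp (by fun_prop) hmaps
  refine Integrable.of_bound (C := C) ?_ ?_
  · have hmeas : Measurable fun s : Icc 0 (x - m) => f (x - s) :=
      (upperSemicontinuousOn_iff_restrict.2 husc).measurable
    exact (aemeasurable_restrict_of_measurable_subtype (f := fun s => f (x - s))
      measurableSet_Icc hmeas).aestronglyMeasurable
  · exact (ae_restrict_iff' measurableSet_Icc).2 (ae_of_all _ fun s hs => hC _ (hmaps hs))

lemma abs_setIntegral_sub_left_le {m M C x : ℝ} {f : ℝ → ℝ} {μ : Measure ℝ}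
    [IsProbabilityMeasure μ] (hC : ∀ z ∈ Icc m M, |f z| ≤ C) (hm : m ≤ x) (hx : x ≤ M) :
    |∫ s in Icc 0 (x - m), f (x - s) ∂μ| ≤ C := by
  have h := norm_setIntegral_le_of_norm_le_const (μ := μ) (s := Icc 0 (x - m))
    (f := fun s => f (x - s)) (C := C) (measure_lt_top _ _)
    (fun s hs => hC _ ⟨by linarith [hs.2], by linarith [hs.1]⟩)
  refine h.trans (mul_le_of_le_one_right ?_ measureReal_le_one)
  exact (abs_nonneg _).trans (hC x ⟨hm, hx⟩)

lemma IsViscositySubsolution.mul_superslope_le {m M lam δ k ξ p C : ℝ} {c G H u : ℝ → ℝ}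
    {μ : Measure ℝ} [IsProbabilityMeasure μ] (hu : IsViscositySubsolution m M lam δ k c μ G H u)
    (hlam : 0 < lam) (hδ : 0 < δ) (hC : ∀ z ∈ Icc m M, |u z| ≤ C) (hξ : ξ ∈ Ioo m M)
    (hM : Mop M k H u ξ < u ξ) (hp : IsSuperslope m M u ξ p) :
    c ξ * p ≤ (δ + 2 * lam) * C + G ξ := by
  have h1 := hu.superslope_le hξ hM hp
  have h2 := mul_le_mul_of_nonneg_left
    (abs_le.1 (abs_setIntegral_sub_left_le (μ := μ) hC hξ.1.le hξ.2.le)).2 hlam.le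
  have h3 := mul_le_mul_of_nonneg_left (abs_le.1 (hC ξ (Ioo_subset_Icc_self hξ))).1
    (add_pos hδ hlam).le
  linarith

lemma IsViscositySupersolution.mul_superslope_neg_le {m M lam δ k ξ p C : ℝ} {c G H v : ℝ → ℝ}
    {μ : Measure ℝ} [IsProbabilityMeasure μ] (hv : IsViscositySupersolution m M lam δ k c μ G H v)
    (hlam : 0 < lam) (hδ : 0 < δ) (hC : ∀ z ∈ Icc m M, |v z| ≤ C) (hξ : ξ ∈ Ioo m M)
    (hp : IsSuperslope m M (fun x => -v x) ξ p) :
    c ξ * p ≤ (δ + 2 * lam) * C - G ξ := by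
  have h1 := (hv.superslope_neg hξ hp).1
  have h2 := mul_le_mul_of_nonneg_left
    (abs_le.1 (abs_setIntegral_sub_left_le (μ := μ) hC hξ.1.le hξ.2.le)).1 hlam.le
  have h3 := mul_le_mul_of_nonneg_left (abs_le.1 (hC ξ (Ioo_subset_Icc_self hξ))).2
    (add_pos hδ hlam).le
  linarith

/-- The largest maximizer of an upper semicontinuous function on a compact interval. -/
lemma UpperSemicontinuousOn.exists_greatest_isMaxOn {m M : ℝ} {w : ℝ → ℝ} (hmM : m ≤ M)
    (hw : UpperSemicontinuousOn w (Icc m M)) :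
    ∃ r ∈ Icc m M, (∀ z ∈ Icc m M, w z ≤ w r) ∧ ∀ z ∈ Icc m M, r < z → w z < w r := by
  obtain ⟨r₀, hr₀, hmax⟩ := hw.exists_isMaxOn (nonempty_Icc.2 hmM) isCompact_Icc
  have hcomp := hw.isCompact_inter_preimage_Ici isCompact_Icc (w r₀)
  obtain ⟨r, ⟨hr, hwr⟩, hgr⟩ := hcomp.exists_isGreatest ⟨r₀, hr₀, le_refl (w r₀)⟩
  have hwr' : w r₀ ≤ w r := hwr
  refine ⟨r, hr, fun z hz => (hmax hz).trans hwr', fun z hz hrz => ?_⟩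
  by_contra! hle
  exact absurd (hgr ⟨hz, hwr'.trans hle⟩) (not_le.2 hrz)

/-- A function that becomes monotone after adding a linear function is almost everywhere
differentiable. -/
lemma ae_differentiableAt_of_monotoneOn_add {a b K : ℝ} {f : ℝ → ℝ}
    (hf : MonotoneOn (fun x => f x + K * x) (Icc a b)) :
    ∀ᵐ x, x ∈ Ioo a b → DifferentiableAt ℝ f x := by
  filter_upwards [hf.ae_differentiableWithinAt_of_mem] with x hx hxm
  have h1 := (hx (Ioo_subset_Icc_self hxm)).differentiableAt (Icc_mem_nhds hxm.1 hxm.2)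
  have h2 : DifferentiableAt ℝ (fun x => f x + K * x - K * x) x := h1.sub (by fun_prop)
  simpa using h2

/-- If `v` satisfies the obstacle inequality at almost every point to the left of `r`, and `v` has
a one-sided Lipschitz bound there, then the obstacle inequality holds at `r`. -/
lemma obstacle_le_of_ae_left {m M K k r z : ℝ} {H v : ℝ → ℝ}
    (hH : ContinuousOn H (Icc m M)) (hr : r ∈ Ioo m M)
    (hmono : MonotoneOn (fun x => v x + K * x) (Icc m r))
    (hobs : ∀ᵐ x, x ∈ Ioo m r → v z - H z + H x - k ≤ v x) :
    v z - H z + H r - k ≤ v r := by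
  by_contra! hlt
  have hHr : ContinuousAt H r :=
    hH.continuousAt (Icc_mem_nhds hr.1 hr.2)
  have hcont : ContinuousAt (fun y => v z - H z + H y - k - (v r + K * (r - y))) r := by fun_prop
  have hev : ∀ᶠ y in 𝓝 r, 0 < v z - H z + H y - k - (v r + K * (r - y)) :=
    hcont.eventually_const_lt (by simpa using hlt)
  obtain ⟨l, hl, hsub⟩ := exists_Ioc_subset_of_mem_nhds hev ⟨m, hr.1⟩
  have hlr : max l m < r := max_lt hl hr.1
  obtain ⟨y, hy⟩ : ∃ y, y ∈ Ioo (max l m) r ∧ v z - H z + H y - k ≤ v y := by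
    by_contra! hcon
    have hnull : volume (Ioo (max l m) r) = 0 := by
      refine measure_mono_null (t := {x | ¬ (x ∈ Ioo m r → v z - H z + H x - k ≤ v x)})
        (fun y hy hP => ?_) (ae_iff.1 hobs)
      exact absurd (hP ⟨(le_max_right _ _).trans_lt hy.1, hy.2⟩) (not_le.2 (hcon y hy))
    rw [Real.volume_Ioo, ENNReal.ofReal_eq_zero] at hnull
    linarith
  have h1 : 0 < v z - H z + H y - k - (v r + K * (r - y)) :=
    hsub ⟨(le_max_left _ _).trans_lt hy.1.1, hy.1.2.le⟩
  have h2 := hmono ⟨((le_max_right _ _).trans_lt hy.1.1).le, hy.1.2.le⟩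
    ⟨hr.1.le, le_rfl⟩ hy.1.2.le
  simp only at h2
  linarith [hy.2]

/-- If every intervention from `r` is strictly suboptimal, then near `r` the intervention operator
stays strictly below `u r`. -/
lemma exists_Mop_le_near {m M k r : ℝ} {H u : ℝ → ℝ} (hr : r ∈ Ioo m M) (hk : 0 < k)
    (hH : ContinuousOn H (Icc m M)) (hu : UpperSemicontinuousOn u (Icc m M))
    (hlt : ∀ z ∈ Icc r M, u z - H z + H r - k < u r) :
    ∃ η > 0, ∃ ρ > 0, Ioo (r - ρ) (r + ρ) ⊆ Ioo m M ∧
      ∀ x ∈ Ioo (r - ρ) (r + ρ), Mop M k H u x ≤ u r - η := by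
  have husc : UpperSemicontinuousOn (fun z => u z + -H z) (Icc m M) :=
    hu.add hH.neg.upperSemicontinuousOn
  have hrm : r ∈ Icc m M := Ioo_subset_Icc_self hr
  obtain ⟨z₀, hz₀, hmax⟩ := (husc.mono (Icc_subset_Icc_left hr.1.le)).exists_isMaxOn
    (nonempty_Icc.2 hr.2.le) isCompact_Icc
  set d : ℝ := u r - (u z₀ - H z₀ + H r - k) with hd
  have hd0 : 0 < d := sub_pos.2 (hlt z₀ hz₀)
  set η : ℝ := min (d / 2) (k / 4) with hη
  have hη0 : 0 < η := by positivity
  have hηd : η ≤ d / 2 := min_le_left _ _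
  have hηk : η ≤ k / 4 := min_le_right _ _
  have hHr : ContinuousAt H r := hH.continuousAt (Icc_mem_nhds hr.1 hr.2)
  have hev1 : ∀ᶠ z in 𝓝 r, u z + -H z < u r + -H r + k / 2 := by
    have := husc r hrm (u r + -H r + k / 2) (by linarith)
    rwa [nhdsWithin_eq_nhds.2 (Icc_mem_nhds hr.1 hr.2)] at this
  have hev2 : ∀ᶠ x in 𝓝 r, H x < H r + η := hHr.eventually_lt_const (by linarith)
  obtain ⟨ρ, hρ, hball⟩ := Metric.eventually_nhds_iff.1
    ((hev1.and hev2).and (Ioo_mem_nhds hr.1 hr.2))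
  have hball' : ∀ x ∈ Ioo (r - ρ) (r + ρ), (u x + -H x < u r + -H r + k / 2 ∧ H x < H r + η) ∧
      x ∈ Ioo m M := fun x hx => hball (by
    rw [Real.dist_eq, abs_lt]; exact ⟨by linarith [hx.1], by linarith [hx.2]⟩)
  refine ⟨η, hη0, ρ, hρ, fun x hx => (hball' x hx).2, fun x hx => ?_⟩
  have hx' := hball' x hx
  refine Mop_le hx'.2.2.le fun z hz => ?_
  rcases lt_or_ge z r with hzr | hzr
  · have := (hball' z ⟨hx.1.trans_le hz.1, by linarith⟩).1.1
    linarith [hx'.1.2]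
  · have : u z + -H z ≤ u z₀ + -H z₀ := hmax (show z ∈ Icc r M from ⟨hzr, hz.2⟩)
    linarith [hx'.1.2]

/-- Proposition 4.1 (comparison principle): a bounded usc subsolution that
lies below a bounded lsc supersolution at the endpoints lies below it on all
of `[m, M]`. -/
theorem comparison_principle
    (m M lam δ k : ℝ) (hmM : m < M) (hlam : 0 < lam) (hδ : 0 < δ) (hk : 0 < k)
    (L : NNReal) (c : ℝ → ℝ)
    (hc_pos : ∀ r ∈ Icc m M, 0 < c r)
    (hc_anti : AntitoneOn c (Icc m M))
    (hc_lip : LipschitzOnWith L c (Icc m M))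
    (μ : Measure ℝ) [IsProbabilityMeasure μ] (hμ : μ (Iio 0) = 0)
    (G H : ℝ → ℝ)
    (hG_cont : ContinuousOn G (Icc m M))
    (hG_nonneg : ∀ r ∈ Icc m M, 0 ≤ G r)
    (hG_mono : MonotoneOn G (Icc m M))
    (hH_cont : ContinuousOn H (Icc m M))
    (hH_mono : StrictMonoOn H (Icc m M))
    (u v : ℝ → ℝ)
    (hu_bdd : ∃ C : ℝ, ∀ r ∈ Icc m M, |u r| ≤ C)
    (hv_bdd : ∃ C : ℝ, ∀ r ∈ Icc m M, |v r| ≤ C)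
    (hu_usc : UpperSemicontinuousOn u (Icc m M))
    (hv_lsc : LowerSemicontinuousOn v (Icc m M))
    (hu_sub : IsViscositySubsolution m M lam δ k c μ G H u)
    (hv_sup : IsViscositySupersolution m M lam δ k c μ G H v)
    (hbm : u m ≤ v m) (hbM : u M ≤ v M) :
    ∀ r ∈ Icc m M, u r ≤ v r := by
  by_contra! hcon
  obtain ⟨Cu, hCu⟩ := hu_bdd
  obtain ⟨Cv, hCv⟩ := hv_bdd
  have hmI : m ∈ Icc m M := left_mem_Icc.2 hmM.le
  have hMI : M ∈ Icc m M := right_mem_Icc.2 hmM.le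
  have hnv_usc : UpperSemicontinuousOn (fun x => -v x) (Icc m M) := hv_lsc.neg
  -- the largest maximizer of `u - v`
  obtain ⟨r, hrI, hmax, hgr⟩ := (hu_usc.add hnv_usc).exists_greatest_isMaxOn hmM.le
  set θ : ℝ := u r - v r with hθ
  have hmax' : ∀ z ∈ Icc m M, u z - v z ≤ θ := fun z hz => by linarith [hmax z hz]
  have hθ0 : 0 < θ := by
    obtain ⟨x, hx, hlt⟩ := hcon
    linarith [hmax' x hx]
  have hr : r ∈ Ioo m M := by
    refine ⟨lt_of_le_of_ne hrI.1 ?_, lt_of_le_of_ne hrI.2 ?_⟩ <;> rintro rfl <;> linarith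
  -- a bound for all slopes
  have hcM := hc_pos M hMI
  have hCu0 : 0 ≤ Cu := (abs_nonneg _).trans (hCu m hmI)
  have hCv0 : 0 ≤ Cv := (abs_nonneg _).trans (hCv m hmI)
  set B : ℝ := (δ + 2 * lam) * (Cu + Cv) + G M with hB
  have hB0 : 0 ≤ B := by have := hG_nonneg M hMI; positivity
  set K : ℝ := B / c M with hK
  have hK0 : 0 ≤ K := by positivity
  have hslope : ∀ ξ ∈ Icc m M, ∀ p, c ξ * p ≤ B → p ≤ K := by
    intro ξ hξ p hp
    rw [hK, le_div_iff₀ hcM]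
    rcases le_total p 0 with h | h
    · nlinarith
    · nlinarith [hc_anti hξ hMI hξ.2]
  have hslope_u : ∀ ξ ∈ Ioo m M, ∀ p, Mop M k H u ξ < u ξ → IsSuperslope m M u ξ p → p ≤ K := by
    intro ξ hξ p hM hp
    have hξI := Ioo_subset_Icc_self hξ
    refine hslope ξ hξI p ?_
    have h1 := hu_sub.mul_superslope_le hlam hδ hCu hξ hM hp
    have h2 := hG_mono hξI hMI hξI.2
    have h3 : 0 ≤ (δ + 2 * lam) * Cv := by positivity
    linarith
  have hslope_v : ∀ ξ ∈ Ioo m M, ∀ p, IsSuperslope m M (fun x => -v x) ξ p → p ≤ K := by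
    intro ξ hξ p hp
    have hξI := Ioo_subset_Icc_self hξ
    refine hslope ξ hξI p ?_
    have h1 := hv_sup.mul_superslope_neg_le hlam hδ hCv hξ hp
    have h2 := hG_nonneg ξ hξI
    have h3 := hG_nonneg M hMI
    have h4 : 0 ≤ (δ + 2 * lam) * Cu := by positivity
    linarith
  have hCu' : ∀ z ∈ Icc m M, u z ≤ Cu := fun z hz => (abs_le.1 (hCu z hz)).2
  have hCv' : ∀ z ∈ Icc m M, v z ≤ Cv := fun z hz => (abs_le.1 (hCv z hz)).2
  have hCnv : ∀ z ∈ Icc m M, -v z ≤ Cv := fun z hz => by linarith [(abs_le.1 (hCv z hz)).1]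
  -- one-sided regularity of `v`, and the obstacle inequality at `r`
  have hv_mono : MonotoneOn (fun x => v x + K * x) (Icc m r) := by
    intro x hx y hy hxy
    have hyI : y ∈ Icc m M := ⟨hy.1, hy.2.trans hrI.2⟩
    have h := sub_le_of_superslope_le (ℓ := -v y - K * (y - x) - 1) (x₁ := y) Subset.rfl hCnv
      hnv_usc hK0 (fun ξ hξ p _ hp => hslope_v ξ hξ p hp) hx.1 hxy (hy.2.trans_lt hr.2)
      (by linarith)
    simp only
    linarith
  have hv_diff := ae_differentiableAt_of_monotoneOn_add hv_mono
  have hobs : ∀ z ∈ Icc r M, v z - H z + H r - k ≤ v r := by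
    intro z hz
    refine obstacle_le_of_ae_left hH_cont hr hv_mono ?_
    filter_upwards [hv_diff] with x hx hxm
    have hxM : x ∈ Ioo m M := ⟨hxm.1, hxm.2.trans hr.2⟩
    have hsl := isSuperslope_of_hasDerivAt hCnv (hx hxm).hasDerivAt.fun_neg
    exact (le_Mop hH_mono hCv' (Ioo_subset_Icc_self hxM) ⟨hxm.2.le.trans hz.1, hz.2⟩).trans
      (hv_sup.superslope_neg hxM hsl).2
  -- no intervention for `u` near `r`
  obtain ⟨η, hη, ρ, hρ, hρI, hMop⟩ := exists_Mop_le_near hr hk hH_cont hu_usc (by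
    intro z hz
    rcases hz.1.eq_or_lt with rfl | hrz
    · linarith
    · linarith [hgr z ⟨hrI.1.trans hz.1, hz.2⟩ hrz, hobs z hz])
  set κ : ℝ := min (η / 2) (δ * θ / (2 * (δ + lam))) with hκ
  have hκ0 : 0 < κ := by positivity
  have hκη : κ ≤ η / 2 := min_le_left _ _
  have hκθ : (δ + lam) * κ ≤ δ * θ / 2 := by
    have h : κ ≤ δ * θ / (2 * (δ + lam)) := min_le_right _ _
    rw [le_div_iff₀ (by positivity)] at h
    linarith
  obtain ⟨d, hd0, hdρ, hdK⟩ : ∃ d > 0, d < ρ ∧ 2 * K * d < κ := by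
    refine ⟨min (ρ / 2) (κ / (2 * (2 * K + 1))), by positivity,
      (min_le_left _ _).trans_lt (by linarith), ?_⟩
    have h : min (ρ / 2) (κ / (2 * (2 * K + 1))) ≤ κ / (2 * (2 * K + 1)) := min_le_right _ _
    rw [le_div_iff₀ (by positivity)] at h
    have h0 : 0 < min (ρ / 2) (κ / (2 * (2 * K + 1))) := by positivity
    nlinarith
  have had : Icc (r - d) (r + d) ⊆ Ioo (r - ρ) (r + ρ) :=
    fun x hx => ⟨by linarith [hx.1], by linarith [hx.2]⟩
  have hKd : ∀ x, r - d ≤ x → K * (r - x) ≤ K * d := fun x hx =>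
    mul_le_mul_of_nonneg_left (by linarith) hK0
  have hu_step : ∀ x y, r - d ≤ x → x ≤ y → y ≤ r → u r - η < u y - K * (y - x) →
      u y - K * (y - x) ≤ u x := fun x y hx hxy hy hlt =>
    sub_le_of_superslope_le ((had.trans hρI).trans Ioo_subset_Icc_self) hCu' hu_usc hK0
      (fun ξ hξ p hlt hp => hslope_u ξ (hρI (had (Ioo_subset_Icc_self hξ))) p
        ((hMop ξ (had (Ioo_subset_Icc_self hξ))).trans_lt hlt) hp) hx hxy (by linarith) hlt
  have hu_low : ∀ x ∈ Icc (r - d) r, u r - K * (r - x) ≤ u x := fun x hx =>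
    hu_step x r hx.1 hx.2 le_rfl (by linarith [hKd x hx.1])
  have hu_mono : MonotoneOn (fun x => -u x + K * x) (Icc (r - d) r) := by
    intro x hx y hy hxy
    have h1 := hu_low y hy
    have h2 := hu_step x y hx.1 hxy hy.2 (by linarith [hKd x hx.1])
    simp only
    linarith
  have hlm : m ≤ r - d := (hρI (had ⟨le_rfl, by linarith⟩)).1.le
  have hv_mono_left := hv_mono.mono (Icc_subset_Icc_left hlm : Icc (r - d) r ⊆ Icc m r)
  have hu_diff := ae_differentiableAt_of_monotoneOn_add hu_mono
  have hv_diff_left := ae_differentiableAt_of_monotoneOn_add hv_mono_left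
  -- a point just below `r` at which `u - v` has a nonnegative derivative
  obtain ⟨x, hx, ⟨hux, hvx⟩, hdx⟩ := (hu_mono.add hv_mono_left).exists_deriv_le_slope
    (P := fun x => DifferentiableAt ℝ (fun y => -u y) x ∧ DifferentiableAt ℝ v x)
    (by linarith) (by
      filter_upwards [hu_diff, hv_diff_left] with x h1 h2 hxm
      exact ⟨h1 hxm, h2 hxm⟩)
  have hux' : DifferentiableAt ℝ u x := by simpa using hux.fun_neg
  have hxI : x ∈ Icc (r - d) r := Ioo_subset_Icc_self hx
  have hxm : x ∈ Ioo m M := hρI (had ⟨hxI.1, by linarith [hxI.2]⟩)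
  have hxmI := Ioo_subset_Icc_self hxm
  have hderiv : deriv (fun y => -u y + K * y + (v y + K * y)) x
      = -deriv u x + K + (deriv v x + K) := by
    have hlin : HasDerivAt (fun y => K * y) K x := by simpa using (hasDerivAt_id x).const_mul K
    exact ((hux'.hasDerivAt.fun_neg.fun_add hlin).fun_add (hvx.hasDerivAt.fun_add hlin)).deriv
  have hpos : 0 ≤ deriv u x - deriv v x := by
    have h1 := hmax' (r - d) ⟨hlm, by linarith [hr.2]⟩
    have h2 : (-deriv u x + K + (deriv v x + K)) * (r - (r - d)) ≤ 2 * K * d := by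
      rw [← hderiv]
      refine hdx.trans ?_
      linarith
    nlinarith
  have hw_low : θ - κ ≤ u x - v x := by
    have h1 := hu_low x hxI
    have h2 := hv_mono_left hxI ⟨by linarith, le_rfl⟩ hxI.2
    simp only at h2
    linarith [hKd x hxI.1]
  have hineq_u := hu_sub.superslope_le hxm (by
    have h1 := hMop x (had ⟨hxI.1, by linarith [hxI.2]⟩)
    have h2 := hu_low x hxI
    linarith [hKd x hxI.1]) (isSuperslope_of_hasDerivAt hCu' hux'.hasDerivAt)
  have hineq_v := (hv_sup.superslope_neg hxm
    (isSuperslope_of_hasDerivAt hCnv hvx.hasDerivAt.fun_neg)).1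
  have hint_u := hu_usc.integrableOn_sub_left (μ := μ) hCu hxmI.2
  have hint_v : IntegrableOn (fun s => v (x - s)) (Icc 0 (x - m)) μ := by
    simpa using (hnv_usc.integrableOn_sub_left (μ := μ) (C := Cv)
      (by simpa using hCv) hxmI.2).neg
  have hint : (∫ s in Icc 0 (x - m), u (x - s) ∂μ) - ∫ s in Icc 0 (x - m), v (x - s) ∂μ ≤ θ := by
    rw [← integral_sub hint_u hint_v]
    refine (setIntegral_mono_on (g := fun _ => θ) (hint_u.sub hint_v) (by simp)
      measurableSet_Icc fun s hs =>
        hmax' _ ⟨by linarith [hs.2], by linarith [hs.1, hxmI.2]⟩).trans ?_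
    rw [setIntegral_const, smul_eq_mul]
    exact mul_le_of_le_one_left hθ0.le measureReal_le_one
  have h1 : 0 ≤ c x * (deriv u x - deriv v x) := mul_nonneg (hc_pos x hxmI).le hpos
  have h2 : (δ + lam) * (θ - κ) ≤ (δ + lam) * (u x - v x) := by gcongr
  have h3 := mul_le_mul_of_nonneg_left hint hlam.le
  have h4 : 0 < δ * θ := by positivity
  linarith
end

section
/- Let v : [m,M] → ℝ be a bounded lower semicontinuous viscosity supersolution of the HJB equation min{ δ f(r) − A(f)(r) − G(r), f(r) − (M f)(r) } = 0 on [m,M]. Let γ ≥ ( k + max_{m ≤ r ≤ M} G(r) ) / δ, let n ≥ 1 be an integer, and define v_n : [m,M] → ℝ by v_n(r) = (1 − 1/n) v(r) + γ/n. Then for every continuously differentiable φ_n : [m,M] → ℝ and every r₀ ∈ (m,M) at which v_n − φ_n attains its minimum over [m,M] with v_n(r₀) = φ_n(r₀), one has min{ δ φ_n(r₀) − A(φ_n, v_n)(r₀) − G(r₀), v_n(r₀) − (M v_n)(r₀) } ≥ k/n. -/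
open MeasureTheory Set

/-- Affine images of the integral over a probability measure; no integrability of `f` is needed
since a nonintegrable `f` gives the junk value `0` on both sides. -/
lemma setIntegral_const_mul_add_const_le (μ : Measure ℝ) [IsProbabilityMeasure μ] (s : Set ℝ)
    (f : ℝ → ℝ) (a : ℝ) {b : ℝ} (hb : 0 ≤ b) :
    ∫ x in s, (a * f x + b) ∂μ ≤ a * (∫ x in s, f x ∂μ) + b := by
  have hconst : ∫ _ in s, b ∂μ ≤ b := by
    simpa using mul_le_of_le_one_left hb measureReal_le_one
  by_cases hf : Integrable (fun x => a * f x) (μ.restrict s)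
  · rw [integral_add hf (integrable_const b), integral_const_mul]
    linarith
  · have hsum : ¬ Integrable (fun x => a * f x + b) (μ.restrict s) := fun h =>
      hf ((h.sub (integrable_const b)).congr (.of_forall fun x => by simp))
    rw [integral_undef hsum, ← integral_const_mul, integral_undef hf]
    linarith

/-- The intervention operator applied to a convex combination with a constant. -/
lemma Mop_const_mul_add_const_le {m M k : ℝ} {H v : ℝ → ℝ} {r : ℝ} (hr : r ∈ Icc m M)
    (hH : MonotoneOn H (Icc m M)) (hv : ∃ C : ℝ, ∀ r ∈ Icc m M, |v r| ≤ C)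
    {t : ℝ} (ht0 : 0 ≤ t) (ht1 : t ≤ 1) (γ : ℝ) :
    Mop M k H (fun r => (1 - t) * v r + γ * t) r ≤ (1 - t) * Mop M k H v r + (γ - k) * t := by
  obtain ⟨C, hC⟩ := hv
  have hmem : ∀ ζ ∈ Icc 0 (M - r), r + ζ ∈ Icc m M := fun ζ hζ =>
    ⟨by linarith [hr.1, hζ.1], by linarith [hζ.2]⟩
  have hHle : ∀ ζ ∈ Icc 0 (M - r), H r ≤ H (r + ζ) := fun ζ hζ =>
    hH hr (hmem ζ hζ) (by linarith [hζ.1])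
  have hbdd : BddAbove ((fun ζ : ℝ => v (r + ζ) - H (r + ζ) + H r - k) '' Icc 0 (M - r)) := by
    refine ⟨C - k, ?_⟩
    rintro _ ⟨ζ, hζ, rfl⟩
    have h := (abs_le.1 (hC _ (hmem ζ hζ))).2
    have h' := hHle ζ hζ
    dsimp only
    linarith
  refine csSup_le ⟨_, 0, ⟨le_rfl, by linarith [hr.2]⟩, rfl⟩ ?_
  rintro _ ⟨ζ, hζ, rfl⟩
  have hle : v (r + ζ) - H (r + ζ) + H r - k ≤ Mop M k H v r :=
    le_csSup hbdd ⟨ζ, hζ, rfl⟩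
  have h₁ := mul_le_mul_of_nonneg_left hle (sub_nonneg.2 ht1)
  have h₂ := mul_nonneg ht0 (sub_nonneg.2 (hHle ζ hζ))
  dsimp only
  linarith

/-- The supersolution inequalities for `v`, tested with a function touching an affine image
`a * v + b` from below. For `a = 0` they reduce to Fermat's rule at an interior maximum. -/
lemma IsViscositySupersolution.of_touching_affine {m M lam δ k : ℝ} {c : ℝ → ℝ} {μ : Measure ℝ}
    {G H v : ℝ → ℝ} (hv : IsViscositySupersolution m M lam δ k c μ G H v) {a b : ℝ} (ha : 0 ≤ a)
    {φ : ℝ → ℝ} (hφ : ContDiff ℝ 1 φ) {r : ℝ} (hr : r ∈ Ioo m M)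
    (hmin : ∀ z ∈ Icc m M, (a * v r + b) - φ r ≤ (a * v z + b) - φ z)
    (heq : a * v r + b = φ r) :
    0 ≤ c r * deriv φ r
        + a * (δ * v r - lam * ((∫ s in Icc 0 (r - m), v (r - s) ∂μ) - v r) - G r) ∧
      0 ≤ a * (v r - Mop M k H v r) := by
  rcases ha.eq_or_lt with rfl | ha
  · have hmax : IsLocalMax φ r := by
      filter_upwards [Icc_mem_nhds hr.1 hr.2] with z hz
      linarith [hmin z hz]
    simp [hmax.deriv_eq_zero]
  · have hscale : ∀ z, a * (a⁻¹ * (φ z - b)) = φ z - b := fun z => by field_simp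
    have htest := hv (fun z => a⁻¹ * (φ z - b)) (by fun_prop) r hr
      (fun z hz => by
        refine le_of_mul_le_mul_left ?_ ha
        linarith [hmin z hz, hscale z, hscale r])
      (by
        refine mul_left_cancel₀ ha.ne' ?_
        rw [hscale]
        linarith)
    have hval : a⁻¹ * (φ r - b) = v r := by
      rw [← heq]
      field_simp
      ring
    have hderiv : deriv (fun z => a⁻¹ * (φ z - b)) r = a⁻¹ * deriv φ r := by
      rw [deriv_const_mul_field, deriv_sub_const]
    obtain ⟨h₁, h₂⟩ := le_min_iff.1 htest
    refine ⟨?_, mul_nonneg ha.le h₂⟩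
    have h := mul_nonneg ha.le h₁
    simp only [Aop, hval, hderiv] at h
    have hcancel : a * (c r * (a⁻¹ * deriv φ r)) = c r * deriv φ r := by field_simp
    linarith

/-- Strict-supersolution perturbation step (inequality (4.7)) in the proof of
the comparison principle: if `v` is a bounded lsc viscosity supersolution and
`γ ≥ (k + max_{[m,M]} G)/δ`, then `v_n = (1 - 1/n) v + γ/n` is a strict
supersolution, with the viscosity inequality improved to `≥ k/n`. -/
theorem strict_supersolution_perturbation
    (m M lam δ k : ℝ) (hmM : m < M) (hlam : 0 < lam) (hδ : 0 < δ) (hk : 0 < k)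
    (L : NNReal) (c : ℝ → ℝ)
    (hc_pos : ∀ r ∈ Icc m M, 0 < c r)
    (hc_anti : AntitoneOn c (Icc m M))
    (hc_lip : LipschitzOnWith L c (Icc m M))
    (μ : Measure ℝ) [IsProbabilityMeasure μ] (hμ : μ (Iio 0) = 0)
    (G H : ℝ → ℝ)
    (hG_cont : ContinuousOn G (Icc m M))
    (hG_nonneg : ∀ r ∈ Icc m M, 0 ≤ G r)
    (hG_mono : MonotoneOn G (Icc m M))
    (hH_cont : ContinuousOn H (Icc m M))
    (hH_mono : StrictMonoOn H (Icc m M))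
    (v : ℝ → ℝ)
    (hv_bdd : ∃ C : ℝ, ∀ r ∈ Icc m M, |v r| ≤ C)
    (hv_lsc : LowerSemicontinuousOn v (Icc m M))
    (hv_sup : IsViscositySupersolution m M lam δ k c μ G H v)
    (γ : ℝ) (hγ : (k + sSup (G '' Icc m M)) / δ ≤ γ)
    (n : ℕ) (hn : 1 ≤ n) :
    ∀ φn : ℝ → ℝ, ContDiff ℝ 1 φn →
      ∀ r₀ ∈ Ioo m M,
        (∀ z ∈ Icc m M,
          ((1 - 1 / (n : ℝ)) * v r₀ + γ / n) - φn r₀ ≤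
            ((1 - 1 / (n : ℝ)) * v z + γ / n) - φn z) →
        (1 - 1 / (n : ℝ)) * v r₀ + γ / n = φn r₀ →
        k / n ≤
          min
            (δ * φn r₀ -
                Aop m lam c μ φn (fun r => (1 - 1 / (n : ℝ)) * v r + γ / n) r₀ -
              G r₀)
            (((1 - 1 / (n : ℝ)) * v r₀ + γ / n) -
              Mop M k H (fun r => (1 - 1 / (n : ℝ)) * v r + γ / n) r₀) := by
  intro φn hφ r₀ hr hmin heq
  have hr' : r₀ ∈ Icc m M := Ioo_subset_Icc_self hr
  have hn1 : (1 : ℝ) ≤ n := by exact_mod_cast hn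
  have ht0 : 0 ≤ 1 / (n : ℝ) := by positivity
  have ht1 : 1 / (n : ℝ) ≤ 1 := (div_le_one (by linarith)).2 hn1
  simp only [div_eq_mul_one_div γ (n : ℝ), div_eq_mul_one_div k (n : ℝ)] at hmin heq ⊢
  set t : ℝ := 1 / (n : ℝ)
  have hGγ : k + G r₀ ≤ δ * γ := by
    have hG : G r₀ ≤ sSup (G '' Icc m M) :=
      le_csSup (isCompact_Icc.bddAbove_image hG_cont) (mem_image_of_mem G hr')
    rw [div_le_iff₀ hδ] at hγ
    linarith
  have hγ0 : 0 ≤ γ := by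
    refine nonneg_of_mul_nonneg_right (a := δ) ?_ hδ
    linarith [hG_nonneg r₀ hr']
  obtain ⟨h₁, h₂⟩ := hv_sup.of_touching_affine (sub_nonneg.2 ht1) hφ hr hmin heq
  refine le_min ?_ ?_
  · have hint := setIntegral_const_mul_add_const_le μ (Icc 0 (r₀ - m)) (fun s => v (r₀ - s))
      (1 - t) (mul_nonneg hγ0 ht0)
    have hint' := mul_le_mul_of_nonneg_left hint hlam.le
    have hrun := mul_le_mul_of_nonneg_left hGγ ht0
    simp only [Aop, ← heq]
    linarith
  · have hM := Mop_const_mul_add_const_le (k := k) hr' hH_mono.monotoneOn hv_bdd ht0 ht1 γ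
    linarith
end
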